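/- Affine invariant complexity bound. Let Q ⊆ ℝⁿ be a compact, convex, centrally symmetric set with nonempty interior, ‖·‖_Q its Minkowski gauge, and f : ℝⁿ → ℝ convex and differentiable with f(y) ≤ f(x) + Df(x)(y − x) + (L_Q/2)·‖y − x‖_Q² for all x, y ∈ Q. Suppose p is a norm on ℝⁿ and 1 ≤ μ ≤ D_Q are constants with: (i) p(y)²/2 ≤ p(x)²/2 + D(p²/2)(x)(y − x) + (μ/2)·p(y − x)² for all x, y; and (ii) (‖x‖_Q*)² ≤ p(x)² ≤ (D_Q/μ)·(‖x‖_Q*)² for all x, where ‖·‖_Q* is the dual norm of ‖·‖_Q. Run Nesterov's smooth algorithm with norm ‖·‖_Q, prox function d(x) = p*(x)²/2 (p* the dual norm of p, recentered so that d vanishes at its minimizer over Q), strong convexity parameter σ = 1/D_Q, and steps αₖ = (k+1)/2: i.e., yₖ minimizes y ↦ Df(xₖ)(y − xₖ) + (L_Q/2)·‖y − xₖ‖_Q² over Q, zₖ minimizes x ↦ (L_Q/σ)·d(x) + Σ_{i=0}^k αᵢ(f(xᵢ) + Df(xᵢ)(x − xᵢ)) over Q, and x_{k+1} = τₖ zₖ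 + (1 − τₖ) yₖ with τₖ = α_{k+1}/Σ_{i=0}^{k+1} αᵢ. Then for any ε > 0, after at most √(8·L_Q·(D_Q/2)/ε) iterations the algorithm produces yₖ with f(yₖ) − min_{x ∈ Q} f(x) ≤ ε. -/

import Mathlib

open scoped InnerProductSpace

/-- The dual norm of a norm `N` on `ℝⁿ`: `N* y = sup {⟨y, x⟩ : N x ≤ 1}`. -/
noncomputable def dualNorm {n : ℕ} (N : EuclideanSpace ℝ (Fin n) → ℝ)
    (y : EuclideanSpace ℝ (Fin n)) : ℝ :=
  sSup ((fun x => ⟪y, x⟫_ℝ) '' {x | N x ≤ 1})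

section DualNorm

variable {n : ℕ} {N : EuclideanSpace ℝ (Fin n) → ℝ}

theorem inner_le_dualNorm {x y : EuclideanSpace ℝ (Fin n)}
    (hbdd : Bornology.IsBounded {x | N x ≤ 1}) (hx : N x ≤ 1) :
    ⟪y, x⟫_ℝ ≤ dualNorm N y := by
  obtain ⟨R, hR⟩ := hbdd.exists_norm_le
  refine le_csSup ⟨‖y‖ * R, ?_⟩ ⟨x, hx, rfl⟩
  rintro _ ⟨z, hz, rfl⟩
  exact (real_inner_le_norm y z).trans (mul_le_mul_of_nonneg_left (hR z hz) (norm_nonneg y))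

theorem dualNorm_nonneg (hbdd : Bornology.IsBounded {x | N x ≤ 1}) (h0 : N 0 ≤ 1)
    (y : EuclideanSpace ℝ (Fin n)) : 0 ≤ dualNorm N y := by
  simpa using inner_le_dualNorm (y := y) hbdd h0

theorem dualNorm_le (h0 : N 0 ≤ 1) {y : EuclideanSpace ℝ (Fin n)} {c : ℝ}
    (h : ∀ x, N x ≤ 1 → ⟪y, x⟫_ℝ ≤ c) : dualNorm N y ≤ c := by
  refine csSup_le ⟨_, 0, h0, rfl⟩ ?_
  rintro _ ⟨x, hx, rfl⟩
  exact h x hx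

theorem inner_le_mul_dualNorm (hbdd : Bornology.IsBounded {x | N x ≤ 1})
    (hnonneg : ∀ x, 0 ≤ N x) (hhom : ∀ c : ℝ, 0 ≤ c → ∀ x, N (c • x) = c * N x)
    (hdef : ∀ x, N x = 0 → x = 0) (x y : EuclideanSpace ℝ (Fin n)) :
    ⟪y, x⟫_ℝ ≤ N x * dualNorm N y := by
  rcases (hnonneg x).eq_or_lt' with h | h
  · rw [h, hdef x h]
    simp
  · have hx : N ((N x)⁻¹ • x) ≤ 1 := by
      rw [hhom _ (inv_nonneg.2 h.le), inv_mul_cancel₀ h.ne']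
    have := inner_le_dualNorm (y := y) hbdd hx
    rwa [real_inner_smul_right, inv_mul_le_iff₀ h] at this

theorem dualNorm_sq_div_le (hhom : ∀ c : ℝ, 0 ≤ c → ∀ x, N (c • x) = c * N x)
    (hnonneg : ∀ x, 0 ≤ N x) (hbdd : Bornology.IsBounded {x | N x ≤ 1})
    {c C : ℝ} (hc : 0 < c) {y : EuclideanSpace ℝ (Fin n)}
    (h : ∀ x, ⟪y, x⟫_ℝ - c / 2 * N x ^ 2 ≤ C) : dualNorm N y ^ 2 / (2 * c) ≤ C := by
  have h00 : N 0 = 0 := by simpa using hhom 0 le_rfl 0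
  have h0 : N 0 ≤ 1 := h00.le.trans zero_le_one
  have hC : 0 ≤ C := by simpa [h00] using h 0
  rcases (dualNorm_nonneg hbdd h0 y).eq_or_lt' with hy | hy
  · simpa [hy] using hC
  set s := dualNorm N y / c with hs
  have hs0 : 0 < s := div_pos hy hc
  have key : dualNorm N y ≤ (C + c / 2 * s ^ 2) / s := by
    refine dualNorm_le h0 fun x hx => ?_
    rw [le_div_iff₀ hs0]
    have h1 := h (s • x)
    rw [real_inner_smul_right, hhom s hs0.le] at h1
    have h2 : (s * N x) ^ 2 ≤ s ^ 2 :=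
      pow_le_pow_left₀ (mul_nonneg hs0.le (hnonneg x)) (mul_le_of_le_one_right hs0.le hx) 2
    nlinarith [mul_le_mul_of_nonneg_left h2 hc.le]
  rw [le_div_iff₀ hs0] at key
  have h1 : dualNorm N y = c * s := by rw [hs]; field_simp
  rw [h1] at key ⊢
  rw [div_le_iff₀ (by positivity)]
  nlinarith

/-- If `N² / 2` is `μ`-smooth with respect to `N`, then `(N*)² / 2` is `1/μ`-strongly convex with
respect to `N*`. -/
theorem dualNorm_sq_strongly_convex (hhom : ∀ c : ℝ, 0 ≤ c → ∀ x, N (c • x) = c * N x)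
    (hneg : ∀ x, N (-x) = N x)
    (hnonneg : ∀ x, 0 ≤ N x) (hbdd : Bornology.IsBounded {x | N x ≤ 1})
    (hdef : ∀ x, N x = 0 → x = 0) {μ : ℝ} (hμ : 0 < μ)
    (hsmooth : ∀ x y, N y ^ 2 / 2 ≤ N x ^ 2 / 2
        + fderiv ℝ (fun z => N z ^ 2 / 2) x (y - x) + μ / 2 * N (y - x) ^ 2)
    (x z : EuclideanSpace ℝ (Fin n)) {t : ℝ} (ht0 : 0 < t) (ht1 : t < 1) :
    dualNorm N (t • x + (1 - t) • z) ^ 2 / 2 + t * (1 - t) / (2 * μ) * dualNorm N (x - z) ^ 2 ≤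
      t * (dualNorm N x ^ 2 / 2) + (1 - t) * (dualNorm N z ^ 2 / 2) := by
  have ht1' : 0 < 1 - t := sub_pos.2 ht1
  have fenchel : ∀ y u, ⟪y, u⟫_ℝ ≤ N u ^ 2 / 2 + dualNorm N y ^ 2 / 2 := fun y u => by
    have := inner_le_mul_dualNorm hbdd hnonneg hhom hdef u y
    nlinarith [sq_nonneg (N u - dualNorm N y)]
  have key : ∀ u h, (⟪t • x + (1 - t) • z, u⟫_ℝ - 1 / 2 * N u ^ 2)
      + t * (1 - t) * (⟪x - z, h⟫_ℝ - μ / 2 * N h ^ 2) ≤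
      t * (dualNorm N x ^ 2 / 2) + (1 - t) * (dualNorm N z ^ 2 / 2) := fun u h => by
    have h1 := fenchel x (u + (1 - t) • h)
    have h2 := fenchel z (u + t • -h)
    have h3 := hsmooth u (u + (1 - t) • h)
    have h4 := hsmooth u (u + t • -h)
    simp only [add_sub_cancel_left, map_smul, map_neg, smul_eq_mul, hhom _ ht0.le,
      hhom _ ht1'.le, hneg, inner_add_right, inner_smul_right, inner_neg_right] at h1 h2 h3 h4
    simp only [inner_add_left, inner_sub_left, real_inner_smul_left]
    linear_combination t * h1 + (1 - t) * h2 + t * h3 + (1 - t) * h4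
  have step : ∀ h, dualNorm N (t • x + (1 - t) • z) ^ 2 / (2 * 1) ≤
      t * (dualNorm N x ^ 2 / 2) + (1 - t) * (dualNorm N z ^ 2 / 2)
        - t * (1 - t) * (⟪x - z, h⟫_ℝ - μ / 2 * N h ^ 2) := fun h =>
    dualNorm_sq_div_le hhom hnonneg hbdd one_pos fun u => by linarith [key u h]
  have htt : 0 < t * (1 - t) := mul_pos ht0 ht1'
  have := dualNorm_sq_div_le (y := x - z) hhom hnonneg hbdd hμ
    (C := (t * (dualNorm N x ^ 2 / 2) + (1 - t) * (dualNorm N z ^ 2 / 2)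
      - dualNorm N (t • x + (1 - t) • z) ^ 2 / 2) / (t * (1 - t))) fun h => by
        rw [le_div_iff₀ htt]
        linarith [step h]
  rw [le_div_iff₀ htt] at this
  linear_combination this

end DualNorm

section Gauge

theorem zero_mem_interior_of_symmetric {E : Type*} [NormedAddCommGroup E] [NormedSpace ℝ E]
    {Q : Set E} (hconv : Convex ℝ Q) (hsymm : ∀ x ∈ Q, -x ∈ Q) (hint : (interior Q).Nonempty) :
    (0 : E) ∈ interior Q := by
  obtain ⟨x, hx⟩ := hint
  have := hconv.combo_interior_self_mem_interior hx (hsymm x (interior_subset hx))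
    (a := 1 / 2) (b := 1 / 2) (by norm_num) (by norm_num) (by norm_num)
  simpa using this

theorem mul_norm_le_dualNorm_gauge {n : ℕ} {Q : Set (EuclideanSpace ℝ (Fin n))}
    (hbdd : Bornology.IsBounded {x | gauge Q x ≤ 1}) {r : ℝ} (hr : 0 ≤ r)
    (hball : Metric.closedBall 0 r ⊆ Q) (u : EuclideanSpace ℝ (Fin n)) :
    r * ‖u‖ ≤ dualNorm (gauge Q) u := by
  rcases eq_or_ne u 0 with rfl | hu
  · simpa using dualNorm_nonneg hbdd (by simp) 0
  have hu' : 0 < ‖u‖ := norm_pos_iff.2 hu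
  have hmem : (r / ‖u‖) • u ∈ Q := hball <| by
    rw [mem_closedBall_zero_iff, norm_smul, norm_div, norm_norm, div_mul_cancel₀ _ hu'.ne',
      Real.norm_of_nonneg hr]
  have := inner_le_dualNorm (y := u) hbdd (gauge_le_one_of_mem hmem)
  rw [real_inner_smul_right, real_inner_self_eq_norm_sq] at this
  calc r * ‖u‖ = r / ‖u‖ * ‖u‖ ^ 2 := by field_simp
    _ ≤ _ := this

/-- One half of the bipolar theorem: a bound of `N` by the dual gauge of `Q` yields a bound of the
gauge of `Q` by the dual norm of `N`. -/
theorem gauge_le_mul_dualNorm {n : ℕ} {Q : Set (EuclideanSpace ℝ (Fin n))}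
    (hconv : Convex ℝ Q) (hclosed : IsClosed Q) (hQ0 : Q ∈ nhds 0)
    {N : EuclideanSpace ℝ (Fin n) → ℝ}
    (hbdd : Bornology.IsBounded {x | N x ≤ 1})
    (hnonneg : ∀ x, 0 ≤ N x) (hhom : ∀ c : ℝ, 0 ≤ c → ∀ x, N (c • x) = c * N x)
    (hdef : ∀ x, N x = 0 → x = 0) {K : ℝ} (hK : 0 ≤ K)
    (hle : ∀ u, N u ≤ K * dualNorm (gauge Q) u) (x : EuclideanSpace ℝ (Fin n)) :
    gauge Q x ≤ K * dualNorm N x := by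
  have h00 : N 0 = 0 := by simpa using hhom 0 le_rfl 0
  have hx0 := dualNorm_nonneg hbdd (h00.le.trans zero_le_one) x
  refine le_of_forall_lt fun t ht => lt_of_not_ge fun hge => ?_
  obtain ⟨r, htr, hr⟩ := exists_between ht
  have hr0 : 0 < r := ((mul_nonneg hK hx0).trans hge).trans_lt htr
  have hmem : r⁻¹ • x ∉ Q := fun hm => by
    have := gauge_le_one_of_mem hm
    rw [gauge_smul_of_nonneg (inv_nonneg.2 hr0.le), smul_eq_mul, inv_mul_le_iff₀ hr0] at this
    linarith
  obtain ⟨g, s, hgs, hsx⟩ := geometric_hahn_banach_closed_point hconv hclosed hmem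
  have hs : 0 < s := by simpa using hgs 0 (mem_of_mem_nhds hQ0)
  set u := (InnerProductSpace.toDual ℝ (EuclideanSpace ℝ (Fin n))).symm g
  have hu : ∀ y, g y = ⟪u, y⟫_ℝ := fun y => (InnerProductSpace.toDual_symm_apply).symm
  have hus : dualNorm (gauge Q) u ≤ s := dualNorm_le (by simp) fun y hy => by
    rw [gauge_le_one_iff_mem_closure hconv hQ0, hclosed.closure_eq] at hy
    exact (hu y) ▸ (hgs y hy).le
  have h1 := inner_le_mul_dualNorm hbdd hnonneg hhom hdef u x
  rw [map_smul, smul_eq_mul, hu, real_inner_comm, lt_inv_mul_iff₀ hr0] at hsx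
  have h2 : N u * dualNorm N x ≤ K * s * dualNorm N x :=
    mul_le_mul_of_nonneg_right ((hle u).trans (mul_le_mul_of_nonneg_left hus hK)) hx0
  nlinarith

end Gauge

section Convergence

theorem ConvexOn.add_fderiv_le {E : Type*} [NormedAddCommGroup E] [NormedSpace ℝ E] {f : E → ℝ}
    (hconv : ConvexOn ℝ Set.univ f) {x : E} (hdiff : DifferentiableAt ℝ f x) (y : E) :
    f x + fderiv ℝ f x (y - x) ≤ f y := by
  have hg : ConvexOn ℝ Set.univ (f ∘ AffineMap.lineMap (k := ℝ) x y) :=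
    hconv.comp_affineMap (AffineMap.lineMap x y)
  have hd : HasDerivAt (f ∘ AffineMap.lineMap (k := ℝ) x y) (fderiv ℝ f x (y - x)) 0 := by
    refine HasFDerivAt.comp_hasDerivAt (0 : ℝ) ?_ AffineMap.hasDerivAt_lineMap
    simpa using hdiff.hasFDerivAt
  have := hg.le_slope_of_hasDerivAt (Set.mem_univ 0) (Set.mem_univ 1) one_pos hd
  simp only [slope_def_field, Function.comp_apply, AffineMap.lineMap_apply_zero,
    AffineMap.lineMap_apply_one, sub_zero, div_one] at this
  linarith

/-- A minimizer of a strongly convex function has quadratic growth. -/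
theorem quadratic_growth_of_minimizer {E : Type*} [AddCommGroup E] [Module ℝ E]
    {Q : Set E} (hQ : Convex ℝ Q) {Ψ : E → ℝ} {ρ : E → ℝ} {x z : E} (hx : x ∈ Q) (hz : z ∈ Q)
    (hmin : ∀ y ∈ Q, Ψ z ≤ Ψ y)
    (hsc : ∀ t : ℝ, 0 < t → t < 1 →
      Ψ (t • x + (1 - t) • z) + t * (1 - t) * ρ (x - z) ≤ t * Ψ x + (1 - t) * Ψ z) :
    Ψ z + ρ (x - z) ≤ Ψ x := by
  have h : ∀ t : ℝ, t ∈ Set.Ioo (0 : ℝ) 1 → (1 - t) * ρ (x - z) ≤ Ψ x - Ψ z := fun t ht => by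
    have h1 := hmin _ (hQ hx hz ht.1.le (sub_pos.2 ht.2).le (by ring) :
      t • x + (1 - t) • z ∈ Q)
    have h2 := hsc t ht.1 ht.2
    refine le_of_mul_le_mul_left ?_ ht.1
    linarith
  have hlim : Filter.Tendsto (fun t : ℝ => (1 - t) * ρ (x - z)) (nhdsWithin 0 (Set.Ioi 0))
      (nhds ((1 - 0) * ρ (x - z))) :=
    (Continuous.tendsto (by fun_prop) 0).mono_left nhdsWithin_le_nhds
  have := le_of_tendsto hlim (Filter.eventually_of_mem (Ioo_mem_nhdsGT one_pos) h)
  linarith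

/-- The estimate sequence inequality of Nesterov's smooth algorithm with `α k = (k+1)/2`, written
with partial sums `(k+1)(k+2)/4`, for a prox function that is strongly convex with respect to a
positively homogeneous `G` and scaled to modulus `L`. -/
theorem nesterov_estimate_sequence {E : Type*} [NormedAddCommGroup E] [NormedSpace ℝ E]
    {Q : Set E} (hQ : Convex ℝ Q) {G : E → ℝ}
    (hG : ∀ c : ℝ, 0 ≤ c → ∀ x, G (c • x) = c * G x)
    {f : E → ℝ} (hfconv : ConvexOn ℝ Set.univ f) (hfdiff : Differentiable ℝ f)
    {L : ℝ} (hL : 0 < L)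
    (hlip : ∀ x ∈ Q, ∀ y ∈ Q, f y ≤ f x + fderiv ℝ f x (y - x) + L / 2 * G (y - x) ^ 2)
    {d : E → ℝ}
    (hd0 : ∀ x, L / 2 * G x ^ 2 ≤ d x)
    (hdsc : ∀ x z, ∀ t : ℝ, 0 < t → t < 1 →
      d (t • x + (1 - t) • z) + t * (1 - t) * (L / 2 * G (x - z) ^ 2) ≤ t * d x + (1 - t) * d z)
    {α τ : ℕ → ℝ} (hα : ∀ k, α k = ((k : ℝ) + 1) / 2)
    (hτ : ∀ k, τ k = 2 / ((k : ℝ) + 3))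
    {xs ys zs : ℕ → E}
    (hxsQ : ∀ k, xs k ∈ Q) (hysQ : ∀ k, ys k ∈ Q) (hzsQ : ∀ k, zs k ∈ Q)
    (hxs0 : xs 0 = 0)
    (hys : ∀ k, ∀ y ∈ Q,
      fderiv ℝ f (xs k) (ys k - xs k) + L / 2 * G (ys k - xs k) ^ 2 ≤
        fderiv ℝ f (xs k) (y - xs k) + L / 2 * G (y - xs k) ^ 2)
    (hzs : ∀ k, ∀ x ∈ Q,
      d (zs k) + ∑ i ∈ Finset.range (k + 1),
          α i * (f (xs i) + fderiv ℝ f (xs i) (zs k - xs i)) ≤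
        d x + ∑ i ∈ Finset.range (k + 1),
          α i * (f (xs i) + fderiv ℝ f (xs i) (x - xs i)))
    (hupdate : ∀ k, xs (k + 1) = τ k • zs k + (1 - τ k) • ys k) (k : ℕ) :
    ∀ x ∈ Q, ((k : ℝ) + 1) * (k + 2) / 4 * f (ys k) ≤
      d x + ∑ i ∈ Finset.range (k + 1),
        α i * (f (xs i) + fderiv ℝ f (xs i) (x - xs i)) := by
  have hstep : ∀ k, ∀ y ∈ Q,
      f (ys k) ≤ f (xs k) + fderiv ℝ f (xs k) (y - xs k) + L / 2 * G (y - xs k) ^ 2 :=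
    fun k y hy => by linarith [hlip _ (hxsQ k) _ (hysQ k), hys k y hy]
  induction k with
  | zero =>
    intro x hx
    have h1 := hstep 0 x hx
    have h2 := hd0 x
    have h3 : 0 ≤ L / 2 * G x ^ 2 := by positivity
    simp only [hxs0, sub_zero] at h1
    simp only [zero_add, Finset.sum_range_one, hα, hxs0, sub_zero, Nat.cast_zero]
    linarith
  | succ k ih =>
    intro x hx
    have hgrow := quadratic_growth_of_minimizer hQ (ρ := fun w => L / 2 * G w ^ 2)
      (Ψ := fun x => d x + ∑ i ∈ Finset.range (k + 1),
        α i * (f (xs i) + fderiv ℝ f (xs i) (x - xs i))) hx (hzsQ k) (hzs k)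
      fun t ht0 ht1 => by
        have hsum : ∑ i ∈ Finset.range (k + 1),
            α i * (f (xs i) + fderiv ℝ f (xs i) (t • x + (1 - t) • zs k - xs i)) =
            t * ∑ i ∈ Finset.range (k + 1), α i * (f (xs i) + fderiv ℝ f (xs i) (x - xs i))
            + (1 - t) * ∑ i ∈ Finset.range (k + 1),
              α i * (f (xs i) + fderiv ℝ f (xs i) (zs k - xs i)) := by
          rw [Finset.mul_sum, Finset.mul_sum, ← Finset.sum_add_distrib]
          refine Finset.sum_congr rfl fun i _ => ?_
          simp only [map_sub, map_add, map_smul, smul_eq_mul]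
          ring
        have := hdsc x (zs k) t ht0 ht1
        simp only [hsum]
        linarith
    have hz := ih (zs k) (hzsQ k)
    have hconv := hfconv.add_fderiv_le (hfdiff (xs (k + 1))) (ys k)
    have hk : (0 : ℝ) ≤ k := k.cast_nonneg
    have hτ0 : 0 ≤ τ k := by rw [hτ]; positivity
    have hτ1 : 0 ≤ 1 - τ k := by
      rw [hτ, sub_nonneg, div_le_one (by positivity)]; linarith
    have hstep' := hstep (k + 1) (τ k • x + (1 - τ k) • ys k)
      (hQ hx (hysQ k) hτ0 hτ1 (by ring))
    have hdir : τ k • x + (1 - τ k) • ys k - xs (k + 1) = τ k • (x - zs k) := by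
      rw [hupdate, smul_sub]; abel
    rw [hdir, hG _ hτ0, map_smul, smul_eq_mul] at hstep'
    have hlin : ((k : ℝ) + 1) * (k + 2) / 4 * fderiv ℝ f (xs (k + 1)) (ys k - xs (k + 1))
        + (k + 2) / 2 * fderiv ℝ f (xs (k + 1)) (x - xs (k + 1)) =
        (k + 2) / 2 * fderiv ℝ f (xs (k + 1)) (x - zs k) := by
      generalize fderiv ℝ f (xs (k + 1)) = g
      simp only [hupdate, hτ, map_sub, map_add, map_smul, smul_eq_mul]
      field_simp
      ring
    rw [Finset.sum_range_succ, hα (k + 1)]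
    push_cast
    have h1 := mul_le_mul_of_nonneg_left hstep'
      (by positivity : (0 : ℝ) ≤ ((k : ℝ) + 2) * (k + 3) / 4)
    have h2 := mul_le_mul_of_nonneg_left hconv
      (by positivity : (0 : ℝ) ≤ ((k : ℝ) + 1) * (k + 2) / 4)
    have h3 : ((k : ℝ) + 2) * (k + 3) / 4 * τ k = (k + 2) / 2 := by
      rw [hτ]; field_simp; ring
    have h4 : ((k : ℝ) + 2) / 2 * τ k ≤ 1 := by
      rw [hτ, div_mul_div_comm, div_le_one (by positivity)]; linarith
    have h5 : 0 ≤ L / 2 * G (x - zs k) ^ 2 := by positivity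
    have h6 : ((k : ℝ) + 2) * (k + 3) / 4 * (L / 2 * (τ k * G (x - zs k)) ^ 2) ≤
        L / 2 * G (x - zs k) ^ 2 := by
      calc _ = (((k : ℝ) + 2) * (k + 3) / 4 * τ k) * τ k * (L / 2 * G (x - zs k) ^ 2) := by ring
        _ ≤ 1 * (L / 2 * G (x - zs k) ^ 2) := by
          rw [h3]; exact mul_le_mul_of_nonneg_right h4 h5
        _ = _ := one_mul _
    linear_combination h1 + h2 + h6 + hz + hgrow - hlin
      + fderiv ℝ f (xs (k + 1)) (x - zs k) * h3

end Convergence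

/-- Affine invariant complexity bound: run Nesterov's smooth algorithm on a compact
convex centrally symmetric `Q`, with norm the Minkowski gauge `‖·‖_Q`, prox function
`d = (p*)²/2` where `p` is a `μ`-smoothing norm witnessing `D_Q`-regularity of
`(ℝⁿ, ‖·‖_Q*)`, strong convexity parameter `σ = 1/D_Q`, and steps `α k = (k+1)/2`.
Then after at most `√(8 L_Q (D_Q/2) / ε)` iterations, `f (ys k) - min_Q f ≤ ε`. -/
theorem nesterov_affine_invariant_complexity {n : ℕ}
    (Q : Set (EuclideanSpace ℝ (Fin n)))
    (hQcomp : IsCompact Q) (hQconv : Convex ℝ Q)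
    (hQsymm : ∀ x ∈ Q, -x ∈ Q) (hQint : (interior Q).Nonempty)
    (f : EuclideanSpace ℝ (Fin n) → ℝ)
    (hfconv : ConvexOn ℝ Set.univ f) (hfdiff : Differentiable ℝ f)
    (L : ℝ) (hL : 0 < L)
    (hlip : ∀ x ∈ Q, ∀ y ∈ Q,
      f y ≤ f x + fderiv ℝ f x (y - x) + L / 2 * gauge Q (y - x) ^ 2)
    (p : EuclideanSpace ℝ (Fin n) → ℝ)
    (hphom : ∀ (c : ℝ) (x), p (c • x) = |c| * p x)
    (hptri : ∀ x y, p (x + y) ≤ p x + p y)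
    (hpdef : ∀ x, p x = 0 → x = 0)
    (μ D : ℝ) (hμ : 1 ≤ μ) (hμD : μ ≤ D)
    (hpdiff : Differentiable ℝ (fun x => p x ^ 2 / 2))
    (hsmooth : ∀ x y, p y ^ 2 / 2 ≤ p x ^ 2 / 2
        + fderiv ℝ (fun z => p z ^ 2 / 2) x (y - x) + μ / 2 * p (y - x) ^ 2)
    (hcomp : ∀ x, dualNorm (gauge Q) x ^ 2 ≤ p x ^ 2 ∧
        p x ^ 2 ≤ D / μ * dualNorm (gauge Q) x ^ 2)
    (d : EuclideanSpace ℝ (Fin n) → ℝ)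
    (hd : ∀ x, d x = dualNorm p x ^ 2 / 2)
    (σ : ℝ) (hσ : σ = 1 / D)
    (α A τ : ℕ → ℝ)
    (hα : ∀ k, α k = ((k : ℝ) + 1) / 2)
    (hA : ∀ k, A k = ∑ i ∈ Finset.range (k + 1), α i)
    (hτ : ∀ k, τ k = α (k + 1) / A (k + 1))
    (xs ys zs : ℕ → EuclideanSpace ℝ (Fin n))
    (hxsQ : ∀ k, xs k ∈ Q) (hysQ : ∀ k, ys k ∈ Q) (hzsQ : ∀ k, zs k ∈ Q)
    (hxs0 : xs 0 = 0)
    (hys : ∀ k, ∀ y ∈ Q,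
      fderiv ℝ f (xs k) (ys k - xs k) + L / 2 * gauge Q (ys k - xs k) ^ 2 ≤
        fderiv ℝ f (xs k) (y - xs k) + L / 2 * gauge Q (y - xs k) ^ 2)
    (hzs : ∀ k, ∀ x ∈ Q,
      L / σ * d (zs k)
          + ∑ i ∈ Finset.range (k + 1),
              α i * (f (xs i) + fderiv ℝ f (xs i) (zs k - xs i)) ≤
        L / σ * d x
          + ∑ i ∈ Finset.range (k + 1),
              α i * (f (xs i) + fderiv ℝ f (xs i) (x - xs i)))
    (hupdate : ∀ k, xs (k + 1) = τ k • zs k + (1 - τ k) • ys k) :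
    ∀ ε : ℝ, 0 < ε → ∀ k : ℕ,
      Real.sqrt (8 * L * (D / 2) / ε) ≤ (k : ℝ) + 1 →
      ∀ xstar ∈ Q, (∀ x ∈ Q, f xstar ≤ f x) →
      f (ys k) - f xstar ≤ ε := by
  have hμ0 : 0 < μ := one_pos.trans_le hμ
  have hD0 : 0 < D := hμ0.trans_le hμD
  have hQ0 : Q ∈ nhds 0 :=
    mem_interior_iff_mem_nhds.1 (zero_mem_interior_of_symmetric hQconv hQsymm hQint)
  have hgset : {x | gauge Q x ≤ 1} = Q := by
    ext x
    rw [Set.mem_ofPred_eq, gauge_le_one_iff_mem_closure hQconv hQ0, hQcomp.isClosed.closure_eq]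
  have hgbdd : Bornology.IsBounded {x | gauge Q x ≤ 1} := hgset.symm ▸ hQcomp.isBounded
  have hghom : ∀ c : ℝ, 0 ≤ c → ∀ x, gauge Q (c • x) = c * gauge Q x :=
    fun c hc x => gauge_smul_of_nonneg hc x
  have hgdef : ∀ x, gauge Q x = 0 → x = 0 := fun x hx =>
    (gauge_eq_zero (absorbent_nhds_zero hQ0)
      ((NormedSpace.isVonNBounded_iff ℝ).2 hQcomp.isBounded)).1 hx
  have hphom' : ∀ c : ℝ, 0 ≤ c → ∀ x, p (c • x) = c * p x := fun c hc x => by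
    rw [hphom, abs_of_nonneg hc]
  have hpneg : ∀ x, p (-x) = p x := fun x => by simpa using hphom (-1) x
  have hp0 : p 0 = 0 := by simpa using hphom 0 0
  have hpnonneg : ∀ x, 0 ≤ p x := fun x => by
    have := hptri x (-x)
    rw [add_neg_cancel, hp0, hpneg] at this
    linarith
  have hgp : ∀ u, dualNorm (gauge Q) u ≤ p u := fun u =>
    le_of_sq_le_sq (hcomp u).1 (hpnonneg u)
  have hpbdd : Bornology.IsBounded {x | p x ≤ 1} := by
    obtain ⟨r, hr, hball⟩ := Metric.nhds_basis_closedBall.mem_iff.1 hQ0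
    refine (Metric.isBounded_closedBall (x := 0) (r := 1 / r)).subset fun u hu => ?_
    rw [mem_closedBall_zero_iff, le_div_iff₀' hr]
    exact ((mul_norm_le_dualNorm_gauge hgbdd hr.le hball u).trans (hgp u)).trans hu
  have hpg : ∀ x, dualNorm p x ≤ gauge Q x := fun x => by
    refine dualNorm_le (hp0.le.trans zero_le_one) fun u hu => ?_
    have := inner_le_mul_dualNorm hgbdd (fun y => gauge_nonneg y) hghom hgdef x u
    rw [real_inner_comm] at this
    exact this.trans (mul_le_of_le_one_right (gauge_nonneg x) ((hgp u).trans hu))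
  have hgsq : ∀ x, gauge Q x ^ 2 ≤ D / μ * dualNorm p x ^ 2 := fun x => by
    have := gauge_le_mul_dualNorm hQconv hQcomp.isClosed hQ0 hpbdd hpnonneg hphom' hpdef
      (Real.sqrt_nonneg (D / μ)) (fun u => le_of_sq_le_sq (by
        rw [mul_pow, Real.sq_sqrt (by positivity)]
        exact (hcomp u).2)
        (mul_nonneg (Real.sqrt_nonneg _) (dualNorm_nonneg hgbdd (by simp) u))) x
    have := pow_le_pow_left₀ (gauge_nonneg x) this 2
    rwa [mul_pow, Real.sq_sqrt (by positivity)] at this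
  have hLσ : L / σ = L * D := by rw [hσ]; field_simp
  have hAk : ∀ k, A k = ((k : ℝ) + 1) * (k + 2) / 4 := fun k => by
    rw [hA]
    induction k with
    | zero => simp [hα]; norm_num
    | succ k ih => rw [Finset.sum_range_succ, ih, hα]; push_cast; ring
  have hτk : ∀ k, τ k = 2 / ((k : ℝ) + 3) := fun k => by
    rw [hτ, hAk, hα]; push_cast; field_simp; ring
  intro ε hε k hk xstar hxstar _
  have hest := nesterov_estimate_sequence hQconv hghom hfconv hfdiff hL hlip
    (d := fun x => L / σ * d x)
    (fun x => by
      simp only [hLσ, hd]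
      have h1 : D / μ * dualNorm p x ^ 2 ≤ D * dualNorm p x ^ 2 :=
        mul_le_mul_of_nonneg_right (div_le_self hD0.le hμ) (sq_nonneg _)
      linear_combination L / 2 * ((hgsq x).trans h1))
    (fun x z t ht0 ht1 => by
      simp only [hLσ, hd]
      have h1 := dualNorm_sq_strongly_convex hphom' hpneg hpnonneg hpbdd hpdef hμ0 hsmooth
        x z ht0 ht1
      have h2 : 0 ≤ t * (1 - t) * L / 2 :=
        div_nonneg (mul_nonneg (mul_nonneg ht0.le (sub_pos.2 ht1).le) hL.le) zero_le_two
      linear_combination L * D * h1 + mul_le_mul_of_nonneg_left (hgsq (x - z)) h2)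
    hα hτk hxsQ hysQ hzsQ hxs0 hys hzs hupdate k xstar hxstar
  have hdstar : d xstar ≤ 1 / 2 := by
    have h1 := pow_le_pow_left₀ (dualNorm_nonneg hpbdd (hp0.le.trans zero_le_one) xstar)
      ((hpg xstar).trans (gauge_le_one_of_mem hxstar)) 2
    rw [hd]
    linarith
  have hsum : ∑ i ∈ Finset.range (k + 1),
      α i * (f (xs i) + fderiv ℝ f (xs i) (xstar - xs i)) ≤ A k * f xstar := by
    rw [hA, Finset.sum_mul]
    refine Finset.sum_le_sum fun i _ => mul_le_mul_of_nonneg_left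
      (hfconv.add_fderiv_le (hfdiff (xs i)) xstar) ?_
    rw [hα]
    positivity
  rw [hAk] at hsum
  have hkε : 8 * L * (D / 2) ≤ ε * ((k : ℝ) + 1) ^ 2 := by
    have := (Real.sqrt_le_left (by positivity)).1 hk
    rwa [div_le_iff₀' hε] at this
  have hLD : L / σ * d xstar ≤ L * D * (1 / 2) := by
    rw [hLσ]
    exact mul_le_mul_of_nonneg_left hdstar (by positivity)
  have hpos : (0 : ℝ) < ((k : ℝ) + 1) * (k + 2) / 4 := by positivity
  refine le_of_mul_le_mul_left ?_ hpos
  have hslack : 0 ≤ ε * ((k : ℝ) + 1) * (k + 3) := by positivity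
  linear_combination hest + hLD + hsum + hkε / 8 + hslack / 8
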